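/- arXiv:1110.1817 — 5 statements merged into one kernel-verified Lean document; each statement's English description precedes it below -/
import Mathlib

section
/- Let w ∈ ℝ⁴ with qw ≠ w and q²w ≠ w, and suppose 0 < β < α and 0 < B < C < A. Define cos φ = g(w,qw)/g(w,w), cos φ₁ = g̃(w,qw)/g̃(w,w), cos ϕ = g(w,q²w)/g(w,w) and cos ϕ₁ = g̃(w,q²w)/g̃(w,w). Then cos φ₁ = (α+β)·cos φ / (α + β·cos ϕ) and cos ϕ₁ = (α·cos ϕ + β)/(α + β·cos ϕ). -/
open Matrix

/-- The 4×4 cyclic-shift (circulant) permutation matrix with first row (0,1,0,0). -/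
def q : Matrix (Fin 4) (Fin 4) ℝ :=
  !![0,1,0,0; 0,0,1,0; 0,0,0,1; 1,0,0,0]

/-- The symmetric 4×4 circulant matrix with first row (A,B,C,B). -/
def gMat (A B C : ℝ) : Matrix (Fin 4) (Fin 4) ℝ :=
  !![A,B,C,B; B,A,B,C; C,B,A,B; B,C,B,A]

/-- The almost conformally transformed metric g̃ = α·g + β·f with f = g·q². -/
def gTilde (A B C α β : ℝ) : Matrix (Fin 4) (Fin 4) ℝ :=
  α • gMat A B C + β • (gMat A B C * q ^ 2)

/-- The bilinear form associated with a 4×4 matrix. -/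
def bil (M : Matrix (Fin 4) (Fin 4) ℝ) (w v : Fin 4 → ℝ) : ℝ :=
  w ⬝ᵥ M.mulVec v

lemma q_mulVec (w : Fin 4 → ℝ) : q.mulVec w = ![w 1, w 2, w 3, w 0] := by
  ext i
  fin_cases i <;> simp [q, mulVec, dotProduct, Fin.sum_univ_four]

lemma q_sq_mulVec (w : Fin 4 → ℝ) : (q ^ 2).mulVec w = ![w 2, w 3, w 0, w 1] := by
  rw [pow_two, ← mulVec_mulVec, q_mulVec, q_mulVec]
  rfl

lemma bil_gMat (A B C : ℝ) (w v : Fin 4 → ℝ) :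
    bil (gMat A B C) w v =
      A * (w 0 * v 0 + w 1 * v 1 + w 2 * v 2 + w 3 * v 3) +
      B * ((w 0 + w 2) * (v 1 + v 3) + (w 1 + w 3) * (v 0 + v 2)) +
      C * (w 0 * v 2 + w 2 * v 0 + w 1 * v 3 + w 3 * v 1) := by
  simp [bil, gMat, mulVec, dotProduct, Fin.sum_univ_four]
  ring

lemma bil_gTilde (A B C α β : ℝ) (w v : Fin 4 → ℝ) :
    bil (gTilde A B C α β) w v =
      α * bil (gMat A B C) w v + β * bil (gMat A B C) w ((q ^ 2).mulVec v) := by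
  simp [bil, gTilde, add_mulVec, smul_mulVec, mulVec_mulVec, dotProduct_add]

lemma bil_gTilde_q (A B C α β : ℝ) (w : Fin 4 → ℝ) :
    bil (gTilde A B C α β) w (q.mulVec w) =
      (α + β) * bil (gMat A B C) w (q.mulVec w) := by
  rw [bil_gTilde, q_sq_mulVec, q_mulVec, bil_gMat, bil_gMat]
  simp
  ring

lemma bil_gTilde_q_sq (A B C α β : ℝ) (w : Fin 4 → ℝ) :
    bil (gTilde A B C α β) w ((q ^ 2).mulVec w) =
      α * bil (gMat A B C) w ((q ^ 2).mulVec w) + β * bil (gMat A B C) w w := by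
  rw [bil_gTilde, q_sq_mulVec, q_sq_mulVec, bil_gMat, bil_gMat, bil_gMat]
  simp

/-- Diagonalization of the quadratic form of `gMat A B C`. -/
lemma bil_gMat_self (A B C : ℝ) (w : Fin 4 → ℝ) :
    bil (gMat A B C) w w =
      (A + C + 2 * B) * (w 0 + w 1 + w 2 + w 3) ^ 2 / 4 +
      (A + C - 2 * B) * (w 0 - w 1 + w 2 - w 3) ^ 2 / 4 +
      (A - C) * ((w 0 - w 2) ^ 2 + (w 1 - w 3) ^ 2) / 2 := by
  rw [bil_gMat]
  ring

lemma bil_gMat_self_pos {A B C : ℝ} (hB : 0 < B) (hBC : B < C) (hCA : C < A)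
    {w : Fin 4 → ℝ} (hw : (q ^ 2).mulVec w ≠ w) : 0 < bil (gMat A B C) w w := by
  have hpos : 0 < (w 0 - w 2) ^ 2 + (w 1 - w 3) ^ 2 := by
    by_contra! h
    have h02 : w 0 = w 2 := by nlinarith [sq_nonneg (w 0 - w 2), sq_nonneg (w 1 - w 3)]
    have h13 : w 1 = w 3 := by nlinarith [sq_nonneg (w 0 - w 2), sq_nonneg (w 1 - w 3)]
    apply hw
    rw [q_sq_mulVec]
    ext i
    fin_cases i <;> simp [h02, h13]
  have h₁ : 0 < A + C + 2 * B := by linarith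
  have h₂ : 0 < A + C - 2 * B := by linarith
  have h₃ : 0 < A - C := by linarith
  rw [bil_gMat_self]
  positivity

theorem stmt_8 (A B C α β : ℝ) (hβ : 0 < β) (hβα : β < α)
    (hB : 0 < B) (hBC : B < C) (hCA : C < A)
    (w : Fin 4 → ℝ) (hqw : q.mulVec w ≠ w) (hq2w : (q ^ 2).mulVec w ≠ w)
    (cosφ : ℝ) (hcosφ : cosφ = bil (gMat A B C) w (q.mulVec w) / bil (gMat A B C) w w)
    (cosφ₁ : ℝ)
    (hcosφ₁ : cosφ₁ = bil (gTilde A B C α β) w (q.mulVec w) / bil (gTilde A B C α β) w w)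
    (cosϕ : ℝ)
    (hcosϕ : cosϕ = bil (gMat A B C) w ((q ^ 2).mulVec w) / bil (gMat A B C) w w)
    (cosϕ₁ : ℝ)
    (hcosϕ₁ : cosϕ₁ =
      bil (gTilde A B C α β) w ((q ^ 2).mulVec w) / bil (gTilde A B C α β) w w) :
    cosφ₁ = (α + β) * cosφ / (α + β * cosϕ) ∧
    cosϕ₁ = (α * cosϕ + β) / (α + β * cosϕ) := by
  have hG := (bil_gMat_self_pos hB hBC hCA hq2w).ne'
  subst hcosφ hcosφ₁ hcosϕ hcosϕ₁
  rw [bil_gTilde_q, bil_gTilde_q_sq, bil_gTilde]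
  constructor <;>
  · rw [← div_div_div_cancel_right₀ hG]
    congr 1 <;> field_simp
end

section
/- Let w ∈ ℝ⁴ with qw ≠ w and q²w ≠ w, and suppose 0 < β < α and 0 < B < C < A. Then the angle φ between w and qw with respect to g equals π/2 if and only if the angle φ₁ between w and qw with respect to g̃ equals π/2; equivalently, g(w,qw) = 0 if and only if g̃(w,qw) = 0. -/
open Matrix

/-- The twisted form `g q²` agrees with `g` on the pair `(w, q w)`. -/
theorem bil_gMat_mul_q_sq (A B C : ℝ) (w : Fin 4 → ℝ) :
    bil (gMat A B C * q ^ 2) w (q.mulVec w) = bil (gMat A B C) w (q.mulVec w) := by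
  simp [bil, gMat, q, pow_two, Matrix.mulVec, dotProduct, Matrix.mul_apply, Fin.sum_univ_four]
  ring

/-- The form attached to a linear combination of matrices. -/
theorem bil_smul_add_smul (a b : ℝ) (M N : Matrix (Fin 4) (Fin 4) ℝ) (w v : Fin 4 → ℝ) :
    bil (a • M + b • N) w v = a * bil M w v + b * bil N w v := by
  simp [bil, Matrix.add_mulVec, Matrix.smul_mulVec]

theorem stmt_9 (A B C α β : ℝ) (hβ : 0 < β) (hβα : β < α)
    (hB : 0 < B) (hBC : B < C) (hCA : C < A)
    (w : Fin 4 → ℝ) (hqw : q.mulVec w ≠ w) (hq2w : (q ^ 2).mulVec w ≠ w) :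
    bil (gMat A B C) w (q.mulVec w) = 0 ↔
      bil (α • gMat A B C + β • (gMat A B C * q ^ 2)) w (q.mulVec w) = 0 := by
  have hne : α + β ≠ 0 := (add_pos (hβ.trans hβα) hβ).ne'
  rw [bil_smul_add_smul, bil_gMat_mul_q_sq, ← add_mul, mul_eq_zero, or_iff_right hne]
end

section
/- Let A, B, C, α, β : ℝ⁴ → ℝ be differentiable functions on an open set F ⊆ ℝ⁴, and let q be the 4×4 cyclic-shift matrix. Suppose that at every point of F: grad A = (grad C)·q², 2·grad B = (grad C)·(q + q³), grad α = (grad β)·q², and grad β = −(grad β)·q² (gradients regarded as row vectors acted on by the matrices). Then at every point of F: grad(αA + βC) = grad(αC + βA)·q² and 2·grad((α+β)B) = grad(αC + βA)·(q + q³). -/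
open Matrix

/-- The gradient of a function Φ : ℝ⁴ → ℝ at a point, viewed as a (row) vector of
partial derivatives. -/
noncomputable def gradVec (Φ : (Fin 4 → ℝ) → ℝ) (p : Fin 4 → ℝ) : Fin 4 → ℝ :=
  fun i => fderiv ℝ Φ p (Pi.single i 1)

theorem gradVec_add {f g : (Fin 4 → ℝ) → ℝ} {p : Fin 4 → ℝ}
    (hf : DifferentiableAt ℝ f p) (hg : DifferentiableAt ℝ g p) :
    gradVec (fun x => f x + g x) p = gradVec f p + gradVec g p := by
  ext i
  simp [gradVec, fderiv_fun_add hf hg]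

theorem gradVec_mul {f g : (Fin 4 → ℝ) → ℝ} {p : Fin 4 → ℝ}
    (hf : DifferentiableAt ℝ f p) (hg : DifferentiableAt ℝ g p) :
    gradVec (fun x => f x * g x) p = f p • gradVec g p + g p • gradVec f p := by
  ext i
  simp [gradVec, fderiv_fun_mul hf hg]

theorem q_pow_four : q ^ 4 = 1 := by
  ext i j
  fin_cases i <;> fin_cases j <;>
    simp [q, pow_succ, Matrix.mul_apply, Fin.sum_univ_four]

theorem vecMul_q_sq_vecMul_q_sq (v : Fin 4 → ℝ) : v ᵥ* q ^ 2 ᵥ* q ^ 2 = v := by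
  rw [vecMul_vecMul, ← pow_add, q_pow_four, vecMul_one]

theorem vecMul_q_sq_vecMul_q_add_q_cube (v : Fin 4 → ℝ) :
    v ᵥ* q ^ 2 ᵥ* (q + q ^ 3) = v ᵥ* (q + q ^ 3) := by
  have h : q ^ 2 * (q + q ^ 3) = q + q ^ 3 := by
    calc q ^ 2 * (q + q ^ 3) = q ^ 3 + q ^ 4 * q := by noncomm_ring
      _ = q + q ^ 3 := by rw [q_pow_four, one_mul, add_comm]
  rw [vecMul_vecMul, h]

theorem stmt_12 (F : Set (Fin 4 → ℝ)) (hF : IsOpen F)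
    (A B C α β : (Fin 4 → ℝ) → ℝ)
    (hA : ∀ p ∈ F, DifferentiableAt ℝ A p)
    (hB : ∀ p ∈ F, DifferentiableAt ℝ B p)
    (hC : ∀ p ∈ F, DifferentiableAt ℝ C p)
    (hα : ∀ p ∈ F, DifferentiableAt ℝ α p)
    (hβ : ∀ p ∈ F, DifferentiableAt ℝ β p)
    (h1 : ∀ p ∈ F, gradVec A p = (gradVec C p) ᵥ* (q ^ 2))
    (h2 : ∀ p ∈ F, (2 : ℝ) • gradVec B p = (gradVec C p) ᵥ* (q + q ^ 3))
    (h3 : ∀ p ∈ F, gradVec α p = (gradVec β p) ᵥ* (q ^ 2))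
    (h4 : ∀ p ∈ F, gradVec β p = -((gradVec β p) ᵥ* (q ^ 2))) :
    ∀ p ∈ F,
      gradVec (fun x => α x * A x + β x * C x) p
          = (gradVec (fun x => α x * C x + β x * A x) p) ᵥ* (q ^ 2) ∧
      (2 : ℝ) • gradVec (fun x => (α x + β x) * B x) p
          = (gradVec (fun x => α x * C x + β x * A x) p) ᵥ* (q + q ^ 3) := by
  intro p hp
  have hα := hα p hp
  have hβ := hβ p hp
  have hA := hA p hp
  have hB := hB p hp
  have hC := hC p hp
  have hβq : gradVec β p ᵥ* q ^ 2 = -gradVec β p := (neg_eq_iff_eq_neg.mpr (h4 p hp)).symm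
  have hαβ : gradVec α p = -gradVec β p := (h3 p hp).trans hβq
  have hβ_zero : gradVec β p ᵥ* (q + q ^ 3) = 0 := by
    have h := vecMul_q_sq_vecMul_q_add_q_cube (gradVec β p)
    rw [hβq, neg_vecMul] at h
    exact neg_eq_self.mp h
  rw [gradVec_add (hα.fun_mul hA) (hβ.fun_mul hC), gradVec_add (hα.fun_mul hC) (hβ.fun_mul hA),
    gradVec_mul hα hA, gradVec_mul hβ hC, gradVec_mul hα hC, gradVec_mul hβ hA,
    gradVec_mul (hα.fun_add hβ) hB, gradVec_add hα hβ, h1 p hp, hαβ]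
  constructor
  · simp only [add_vecMul, smul_vecMul, neg_vecMul, hβq, vecMul_q_sq_vecMul_q_sq]
    module
  · rw [neg_add_cancel, smul_zero, add_zero, smul_comm, h2 p hp]
    simp only [add_vecMul, smul_vecMul, neg_vecMul, hβ_zero, vecMul_q_sq_vecMul_q_add_q_cube]
    module
end

section
/- Let A, B, C, α, β : ℝ⁴ → ℝ be differentiable functions on an open set F ⊆ ℝ⁴ with A > C > B > 0 on F, and let q be the 4×4 cyclic-shift matrix. Suppose that at every point of F: grad A = (grad C)·q², 2·grad B = (grad C)·(q + q³), and also A·grad α + C·grad β = (C·grad α + A·grad β)·q² and 2B·(grad α + grad β) = (C·grad α + A·grad β)·(q + q³). Then at every point of F: grad α = (grad β)·q² and grad β = −(grad β)·q². -/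
open Matrix

theorem vecMul_q_sq (v : Fin 4 → ℝ) : v ᵥ* (q ^ 2) = ![v 2, v 3, v 0, v 1] := by
  ext i
  fin_cases i <;> simp [q, pow_two, vecMul, dotProduct, Fin.sum_univ_four, mul_apply]

theorem vecMul_q_add_q_cube (v : Fin 4 → ℝ) :
    v ᵥ* (q + q ^ 3) = ![v 1 + v 3, v 0 + v 2, v 1 + v 3, v 0 + v 2] := by
  have hq : q ^ 3 = !![0,0,0,1; 1,0,0,0; 0,1,0,0; 0,0,1,0] := by
    ext i j
    fin_cases i <;> fin_cases j <;> simp [q, pow_succ, Fin.sum_univ_four, mul_apply]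
  rw [hq]
  ext i
  fin_cases i <;> simp [q, vecMul, dotProduct, Fin.sum_univ_four, add_comm]

/-- A nondegenerate symmetric pair of relations forces the unknowns to agree crosswise. -/
theorem eq_and_eq_of_swap_relations {A C a a' b b' : ℝ} (hC : 0 < C) (hCA : C < A)
    (h : A * a + C * b = C * a' + A * b') (h' : A * a' + C * b' = C * a + A * b) :
    a = b' ∧ a' = b := by
  have hs : a + a' - b - b' = 0 := by
    refine (mul_eq_zero.mp (?_ : (A - C) * _ = 0)).resolve_left (by linarith)
    linear_combination h + h'
  have hd : a - a' + b - b' = 0 := by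
    refine (mul_eq_zero.mp (?_ : (A + C) * _ = 0)).resolve_left (by linarith)
    linear_combination h - h'
  constructor <;> linarith

/-- If `s` and `t` are proportional to each other with unequal positive coefficients,
both vanish. -/
theorem eq_zero_of_mul_eq_mul_swap {x y s t : ℝ} (hx : 0 < x) (hxy : x < y)
    (h : x * s = y * t) (h' : x * t = y * s) : s = 0 ∧ t = 0 := by
  have hs : s + t = 0 := by
    refine (mul_eq_zero.mp (?_ : (y - x) * _ = 0)).resolve_left (by linarith)
    linear_combination -h - h'
  have hd : s - t = 0 := by
    refine (mul_eq_zero.mp (?_ : (x + y) * _ = 0)).resolve_left (by linarith)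
    linear_combination h - h'
  constructor <;> linarith

/-- The pointwise linear algebra behind `stmt_13`. -/
theorem eq_vecMul_q_sq_of_relations {A B C : ℝ} {a b : Fin 4 → ℝ}
    (hB : 0 < B) (hBC : B < C) (hCA : C < A)
    (h₁ : A • a + C • b = (C • a + A • b) ᵥ* (q ^ 2))
    (h₂ : (2 * B) • (a + b) = (C • a + A • b) ᵥ* (q + q ^ 3)) :
    a = b ᵥ* (q ^ 2) ∧ b = -(b ᵥ* (q ^ 2)) := by
  rw [vecMul_q_sq] at h₁ ⊢
  rw [vecMul_q_add_q_cube] at h₂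
  simp only [funext_iff, Fin.forall_fin_succ, Fin.isValue] at h₁ h₂ ⊢
  simp at h₁ h₂ ⊢
  obtain ⟨e0, e1, e2, e3⟩ := h₁
  obtain ⟨f0, f1, -, -⟩ := h₂
  obtain ⟨h02, h20⟩ := eq_and_eq_of_swap_relations (hB.trans hBC) hCA e0 e2
  obtain ⟨h13, h31⟩ := eq_and_eq_of_swap_relations (hB.trans hBC) hCA e1 e3
  rw [h02, h13, h31] at f0
  rw [h02, h13, h20] at f1
  obtain ⟨hs, ht⟩ := eq_zero_of_mul_eq_mul_swap (x := 2 * B) (y := A + C)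
    (s := b 0 + b 2) (t := b 1 + b 3) (by linarith) (by linarith)
    (by linear_combination f0) (by linear_combination f1)
  refine ⟨⟨h02, h13, h20, h31⟩, ?_, ?_, ?_, ?_⟩ <;> linarith

theorem stmt_13 (F : Set (Fin 4 → ℝ)) (hF : IsOpen F)
    (A B C α β : (Fin 4 → ℝ) → ℝ)
    (hpos : ∀ p ∈ F, 0 < B p ∧ B p < C p ∧ C p < A p)
    (hA : ∀ p ∈ F, DifferentiableAt ℝ A p)
    (hB : ∀ p ∈ F, DifferentiableAt ℝ B p)
    (hC : ∀ p ∈ F, DifferentiableAt ℝ C p)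
    (hα : ∀ p ∈ F, DifferentiableAt ℝ α p)
    (hβ : ∀ p ∈ F, DifferentiableAt ℝ β p)
    (h1 : ∀ p ∈ F, gradVec A p = (gradVec C p) ᵥ* (q ^ 2))
    (h2 : ∀ p ∈ F, (2 : ℝ) • gradVec B p = (gradVec C p) ᵥ* (q + q ^ 3))
    (h3 : ∀ p ∈ F,
      A p • gradVec α p + C p • gradVec β p
        = (C p • gradVec α p + A p • gradVec β p) ᵥ* (q ^ 2))
    (h4 : ∀ p ∈ F,
      (2 * B p) • (gradVec α p + gradVec β p)
        = (C p • gradVec α p + A p • gradVec β p) ᵥ* (q + q ^ 3)) :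
    ∀ p ∈ F,
      gradVec α p = (gradVec β p) ᵥ* (q ^ 2) ∧
      gradVec β p = -((gradVec β p) ᵥ* (q ^ 2)) := by
  intro p hp
  obtain ⟨hBp, hBC, hCA⟩ := hpos p hp
  exact eq_vecMul_q_sq_of_relations hBp hBC hCA (h3 p hp) (h4 p hp)
end

section
/- Let 0 < β < α and 0 < B < C < A be real numbers, let g₀ = g be the circulant matrix with first row (A,B,C,B), and define recursively gₙ = α·gₙ₋₁ + β·fₙ₋₁ where fₙ₋₁ = gₙ₋₁·q² (entrywise, fₙ₋₁,ᵢₛ = gₙ₋₁,ₖₐ q^a_s q^k_i). Then for every n ≥ 0 the matrix gₙ is a symmetric circulant matrix of the form with first row (Aₙ, Bₙ, Cₙ, Bₙ) and gₙ is positive definite. -/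
open Matrix

lemma gMat_isHermitian (A B C : ℝ) : (gMat A B C).IsHermitian := by
  ext i j
  fin_cases i <;> fin_cases j <;> simp [gMat]

lemma gMat_quadraticForm (A B C : ℝ) (x : Fin 4 → ℝ) :
    x ⬝ᵥ (gMat A B C *ᵥ x) =
      (A - C) / 2 * ((x 0 - x 2) ^ 2 + (x 1 - x 3) ^ 2) +
        (A + C + 2 * B) / 4 * (x 0 + x 1 + x 2 + x 3) ^ 2 +
        (A + C - 2 * B) / 4 * (x 0 - x 1 + x 2 - x 3) ^ 2 := by
  simp [gMat, dotProduct, mulVec, Fin.sum_univ_four]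
  ring

/-- The hypotheses say that the eigenvalues `A - C` and `A + C ± 2 * B` are positive. -/
lemma gMat_posDef {A B C : ℝ} (hCA : 0 < A - C) (hplus : 0 < A + C + 2 * B)
    (hminus : 0 < A + C - 2 * B) : (gMat A B C).PosDef := by
  refine PosDef.of_dotProduct_mulVec_pos (gMat_isHermitian A B C) fun x hx => ?_
  rw [star_trivial, gMat_quadraticForm]
  by_contra! hle
  have h₁ : 0 ≤ (A - C) / 2 * (x 0 - x 2) ^ 2 := by positivity
  have h₂ : 0 ≤ (A - C) / 2 * (x 1 - x 3) ^ 2 := by positivity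
  have h₃ : 0 ≤ (A + C + 2 * B) / 4 * (x 0 + x 1 + x 2 + x 3) ^ 2 := by positivity
  have h₄ : 0 ≤ (A + C - 2 * B) / 4 * (x 0 - x 1 + x 2 - x 3) ^ 2 := by positivity
  have of_mul_sq_nonpos {c y : ℝ} (hc : 0 < c) (h : c * y ^ 2 ≤ 0) : y = 0 :=
    pow_eq_zero_iff two_ne_zero |>.1 (le_antisymm (nonpos_of_mul_nonpos_right h hc) (sq_nonneg y))
  have e₁ := of_mul_sq_nonpos (half_pos hCA) (y := x 0 - x 2) (by linarith)
  have e₂ := of_mul_sq_nonpos (half_pos hCA) (y := x 1 - x 3) (by linarith)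
  have e₃ := of_mul_sq_nonpos (by positivity : 0 < (A + C + 2 * B) / 4)
    (y := x 0 + x 1 + x 2 + x 3) (by linarith)
  have e₄ := of_mul_sq_nonpos (by positivity : 0 < (A + C - 2 * B) / 4)
    (y := x 0 - x 1 + x 2 - x 3) (by linarith)
  refine hx (funext fun i => ?_)
  fin_cases i <;> simp <;> linarith

lemma smul_gMat_add_smul_gMat_mul_q_sq (A B C α β : ℝ) :
    α • gMat A B C + β • (gMat A B C * q ^ 2) =
      gMat (α * A + β * C) (α * B + β * B) (α * C + β * A) := by
  ext i j
  fin_cases i <;> fin_cases j <;> simp [gMat, q, pow_two]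

theorem stmt_14 (A B C α β : ℝ) (hβ : 0 < β) (hβα : β < α)
    (hB : 0 < B) (hBC : B < C) (hCA : C < A)
    (gs : ℕ → Matrix (Fin 4) (Fin 4) ℝ)
    (h0 : gs 0 = gMat A B C)
    (hrec : ∀ n, gs (n + 1) = α • gs n + β • (gs n * q ^ 2)) :
    ∀ n, (∃ An Bn Cn : ℝ, gs n = gMat An Bn Cn) ∧ (gs n).PosDef := by
  have key : ∀ n, ∃ An Bn Cn : ℝ, gs n = gMat An Bn Cn ∧
      0 < An - Cn ∧ 0 < An + Cn + 2 * Bn ∧ 0 < An + Cn - 2 * Bn := by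
    intro n
    induction n with
    | zero => exact ⟨A, B, C, h0, by linarith, by linarith, by linarith⟩
    | succ n ih =>
      obtain ⟨a, b, c, hg, hca, hplus, hminus⟩ := ih
      refine ⟨_, _, _, by rw [hrec, hg, smul_gMat_add_smul_gMat_mul_q_sq], ?_, ?_, ?_⟩
      · linear_combination mul_pos (sub_pos.2 hβα) hca
      · linear_combination mul_pos (by linarith : 0 < α + β) hplus
      · linear_combination mul_pos (by linarith : 0 < α + β) hminus
  intro n
  obtain ⟨a, b, c, hg, hca, hplus, hminus⟩ := key n
  exact ⟨⟨a, b, c, hg⟩, hg ▸ gMat_posDef hca hplus hminus⟩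
end
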